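/- arXiv:2402.18949 — 2 statements merged into one kernel-verified Lean document; each statement's English description precedes it below -/
import Mathlib

section
/- Let h, l ≥ 1, b, d, d_anc > 0, δ ∈ (0,1). Fix an anchor (U*, v*) with U* ∈ ℝ^{h×l}, v* ∈ ℝ^h, ‖v*‖₂ ≤ d_anc; fix x ∈ ℝ^l with ‖x‖₂ ≤ b and α ∈ [0,1]. Let (U₁, v₁) and (U₂, v₂) be independent random parameter pairs whose hl + h scalar entries are all independent, each uniformly distributed on the interval of length d centered at the corresponding entry of (U*, v*). Then with probability at least 1 − δ: |(αv₁+(1−α)v₂)ᵀσ((αU₁+(1−α)U₂)x) − α v₁ᵀσ(U₁ x) − (1−α) v₂ᵀσ(U₂ x)| ≤ (√2/2) √h b (d² + d·d_anc) log(12h/δ). -/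
open MeasureTheory

/-- The Euclidean (ℓ²) norm of a vector in `Fin n → ℝ`. -/
noncomputable def l2norm {n : ℕ} (v : Fin n → ℝ) : ℝ :=
  Real.sqrt (∑ i, (v i) ^ 2)

/-- The two-layer ReLU network `f_{v,U}(x) = vᵀ σ(U x)`. -/
noncomputable def net {hd ld : ℕ} (U : Fin hd → Fin ld → ℝ) (v : Fin hd → ℝ)
    (x : Fin ld → ℝ) : ℝ :=
  ∑ i, v i * max 0 (∑ j, U i j * x j)

/-- The uniform probability distribution on the interval `[a, b]`. -/
noncomputable def unif (a b : ℝ) : Measure ℝ :=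
  (ENNReal.ofReal (b - a))⁻¹ • volume.restrict (Set.Icc a b)

/-- The law of a random parameter pair `(U, v)` whose `hl + h` scalar entries are
independent, each uniform on the interval of length `d` centered at the
corresponding entry of the anchor `(Uanc, vanc)`. -/
noncomputable def paramUnif {hd ld : ℕ} (Uanc : Fin hd → Fin ld → ℝ)
    (vanc : Fin hd → ℝ) (d : ℝ) :
    Measure ((Fin hd → Fin ld → ℝ) × (Fin hd → ℝ)) :=
  (Measure.pi fun i => Measure.pi fun j =>
      unif (Uanc i j - d / 2) (Uanc i j + d / 2)).prod
    (Measure.pi fun i => unif (vanc i - d / 2) (vanc i + d / 2))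

open ProbabilityTheory

theorem isProbabilityMeasure_unif (c : ℝ) {d : ℝ} (hd : 0 < d) :
    IsProbabilityMeasure (unif (c - d / 2) (c + d / 2)) := by
  have h : c + d / 2 - (c - d / 2) = d := by ring
  refine ⟨?_⟩
  rw [unif, Measure.smul_apply, Measure.restrict_apply_univ, Real.volume_Icc, h, smul_eq_mul]
  exact ENNReal.inv_mul_cancel (by simpa using hd) ENNReal.ofReal_ne_top

theorem ae_mem_Icc_unif (a b : ℝ) : ∀ᵐ y ∂unif a b, y ∈ Set.Icc a b :=
  Measure.ae_smul_measure (ae_restrict_mem measurableSet_Icc) _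

theorem integral_id_unif (c : ℝ) {d : ℝ} (hd : 0 < d) :
    ∫ y, y ∂unif (c - d / 2) (c + d / 2) = c := by
  have h : c + d / 2 - (c - d / 2) = d := by ring
  rw [unif, integral_smul_measure, h, integral_Icc_eq_integral_Ioc,
    ← intervalIntegral.integral_of_le (by linarith), integral_id, ENNReal.toReal_inv,
    ENNReal.toReal_ofReal hd.le, smul_eq_mul]
  field_simp
  ring

theorem hasSubgaussianMGF_sub_unif (c : ℝ) {d : ℝ} (hd : 0 < d) :
    HasSubgaussianMGF (fun y ↦ y - c) ((‖d‖₊ / 2) ^ 2) (unif (c - d / 2) (c + d / 2)) := by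
  have := isProbabilityMeasure_unif c hd
  have h := hasSubgaussianMGF_of_mem_Icc (X := fun y ↦ y) aemeasurable_id'
    (ae_mem_Icc_unif (c - d / 2) (c + d / 2))
  rwa [integral_id_unif c hd, show c + d / 2 - (c - d / 2) = d by ring] at h

theorem l2norm_nonneg {n : ℕ} (v : Fin n → ℝ) : 0 ≤ l2norm v := Real.sqrt_nonneg _

theorem l2norm_sq {n : ℕ} (v : Fin n → ℝ) : l2norm v ^ 2 = ∑ i, v i ^ 2 :=
  Real.sq_sqrt (Finset.sum_nonneg fun i _ ↦ sq_nonneg (v i))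

theorem l2norm_neg {n : ℕ} (v : Fin n → ℝ) : l2norm (-v) = l2norm v := by
  simp [l2norm]

theorem eq_zero_of_l2norm_eq_zero {n : ℕ} {v : Fin n → ℝ} (h : l2norm v = 0) (i : Fin n) :
    v i = 0 := by
  have h' := l2norm_sq v
  rw [h, zero_pow two_ne_zero, eq_comm,
    Finset.sum_eq_zero_iff_of_nonneg fun i _ ↦ sq_nonneg (v i)] at h'
  exact pow_eq_zero_iff two_ne_zero |>.1 (h' i (Finset.mem_univ i))

theorem abs_sum_mul_le_l2norm_mul_l2norm {n : ℕ} (v w : Fin n → ℝ) :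
    |∑ i, v i * w i| ≤ l2norm v * l2norm w := by
  refine abs_le_of_sq_le_sq ?_ (mul_nonneg (l2norm_nonneg v) (l2norm_nonneg w))
  rw [mul_pow, l2norm_sq, l2norm_sq]
  exact Finset.sum_mul_sq_le_sq_mul_sq _ _ _

theorem l2norm_le_sqrt_mul {n : ℕ} {v : Fin n → ℝ} {M : ℝ} (hM : 0 ≤ M) (h : ∀ i, |v i| ≤ M) :
    l2norm v ≤ Real.sqrt n * M := by
  rw [l2norm, ← Real.sqrt_sq hM, ← Real.sqrt_mul (Nat.cast_nonneg n)]
  refine Real.sqrt_le_sqrt ?_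
  calc ∑ i, v i ^ 2 ≤ ∑ _i : Fin n, M ^ 2 :=
        Finset.sum_le_sum fun i _ ↦ sq_le_sq' (abs_le.1 (h i)).1 (abs_le.1 (h i)).2
    _ = n * M ^ 2 := by simp

theorem measureReal_pi_unif_sum_ge_le {n : ℕ} (c w : Fin n → ℝ) {d s : ℝ} (hd : 0 < d)
    (hs : 0 ≤ s) (hw : l2norm w ≠ 0) :
    (Measure.pi fun i ↦ unif (c i - d / 2) (c i + d / 2)).real
      {y | d * l2norm w * s ≤ ∑ i, w i * (y i - c i)} ≤ Real.exp (-(2 * s ^ 2)) := by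
  have := fun i ↦ isProbabilityMeasure_unif (c i) hd
  have hsub : ∀ i ∈ Finset.univ, HasSubgaussianMGF (fun y : Fin n → ℝ ↦ w i * (y i - c i))
      (NNReal.mk (w i ^ 2) (sq_nonneg _) * (‖d‖₊ / 2) ^ 2)
      (Measure.pi fun i ↦ unif (c i - d / 2) (c i + d / 2)) := fun i _ ↦
    HasSubgaussianMGF.of_map (Y := fun y : Fin n → ℝ ↦ y i) (X := fun t ↦ w i * (t - c i))
      (measurable_pi_apply i).aemeasurable (by
        rw [(measurePreserving_eval (fun i ↦ unif (c i - d / 2) (c i + d / 2)) i).map_eq]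
        exact (hasSubgaussianMGF_sub_unif (c i) hd).const_mul (w i))
  have hindep : iIndepFun (fun i (y : Fin n → ℝ) ↦ w i * (y i - c i))
      (Measure.pi fun i ↦ unif (c i - d / 2) (c i + d / 2)) :=
    iIndepFun_pi (X := fun i t ↦ w i * (t - c i)) fun i ↦ by fun_prop
  refine (HasSubgaussianMGF.measure_sum_ge_le_of_iIndepFun hindep hsub
    (mul_nonneg (mul_nonneg hd.le (l2norm_nonneg w)) hs)).trans_eq ?_
  congr 1
  rw [NNReal.coe_sum]
  simp only [NNReal.coe_mul, NNReal.coe_mk, NNReal.coe_pow, NNReal.coe_div, coe_nnnorm,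
    Real.norm_eq_abs, abs_of_pos hd, NNReal.coe_ofNat]
  rw [← Finset.sum_mul, ← l2norm_sq]
  field_simp

/-- Two-sided **Hoeffding inequality** for a linear form in independent uniform variables. -/
theorem measure_pi_unif_abs_sum_gt_le {n : ℕ} (c w : Fin n → ℝ) {d s : ℝ} (hd : 0 < d)
    (hs : 0 ≤ s) :
    (Measure.pi fun i ↦ unif (c i - d / 2) (c i + d / 2))
      {y | d * l2norm w * s < |∑ i, w i * (y i - c i)|}
      ≤ ENNReal.ofReal (2 * Real.exp (-(2 * s ^ 2))) := by
  have := fun i ↦ isProbabilityMeasure_unif (c i) hd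
  by_cases hw : l2norm w = 0
  · simp [hw, eq_zero_of_l2norm_eq_zero hw]
  have h₁ := measureReal_pi_unif_sum_ge_le c w hd hs hw
  have h₂ := measureReal_pi_unif_sum_ge_le c (-w) hd hs (by rwa [l2norm_neg])
  rw [l2norm_neg] at h₂
  rw [← ofReal_measureReal]
  refine ENNReal.ofReal_le_ofReal ?_
  refine (measureReal_mono (s₂ := {y | d * l2norm w * s ≤ ∑ i, w i * (y i - c i)} ∪
    {y | d * l2norm w * s ≤ ∑ i, (-w) i * (y i - c i)}) fun y hy ↦ ?_).trans
    ((measureReal_union_le _ _).trans (by linarith))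
  simp only [Pi.neg_apply, neg_mul, Finset.sum_neg_distrib, Set.mem_union, Set.mem_ofPred_eq]
  exact (lt_abs.1 hy).imp le_of_lt le_of_lt

theorem measure_prod_le_of_forall_left {X Y : Type*} [MeasurableSpace X] [MeasurableSpace Y]
    {μ : Measure X} {ν : Measure Y} [IsProbabilityMeasure μ] [SFinite ν] {s : Set (X × Y)}
    (hs : MeasurableSet s) {p : ENNReal} (h : ∀ x, ν {y | (x, y) ∈ s} ≤ p) : μ.prod ν s ≤ p := by
  rw [Measure.prod_apply hs]
  exact (lintegral_mono h).trans_eq (by simp)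

theorem measure_prod_le_of_forall_right {X Y : Type*} [MeasurableSpace X] [MeasurableSpace Y]
    {μ : Measure X} {ν : Measure Y} [SFinite μ] [IsProbabilityMeasure ν] {s : Set (X × Y)}
    (hs : MeasurableSet s) {p : ENNReal} (h : ∀ y, μ {x | (x, y) ∈ s} ≤ p) : μ.prod ν s ≤ p := by
  rw [Measure.prod_apply_symm hs]
  exact (lintegral_mono h).trans_eq (by simp)

theorem isProbabilityMeasure_paramUnif {hd ld : ℕ} (Uanc : Fin hd → Fin ld → ℝ)
    (vanc : Fin hd → ℝ) {d : ℝ} (hd' : 0 < d) :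
    IsProbabilityMeasure (paramUnif Uanc vanc d) := by
  have := fun i j ↦ isProbabilityMeasure_unif (Uanc i j) hd'
  have := fun i ↦ isProbabilityMeasure_unif (vanc i) hd'
  unfold paramUnif
  infer_instance

theorem measure_paramUnif_row_gt_le {hd ld : ℕ} (Uanc : Fin hd → Fin ld → ℝ)
    (vanc : Fin hd → ℝ) {d s : ℝ} (hd' : 0 < d) (hs : 0 ≤ s) (x : Fin ld → ℝ) (i : Fin hd) :
    paramUnif Uanc vanc d {p | d * l2norm x * s < |∑ j, x j * (p.1 i j - Uanc i j)|}
      ≤ ENNReal.ofReal (2 * Real.exp (-(2 * s ^ 2))) := by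
  have := fun i j ↦ isProbabilityMeasure_unif (Uanc i j) hd'
  have := fun i ↦ isProbabilityMeasure_unif (vanc i) hd'
  have hmeas : MeasurableSet
      {r : Fin ld → ℝ | d * l2norm x * s < |∑ j, x j * (r j - Uanc i j)|} :=
    measurableSet_lt (by fun_prop) (by fun_prop)
  have hmp := (measurePreserving_eval (fun i ↦ Measure.pi fun j ↦
    unif (Uanc i j - d / 2) (Uanc i j + d / 2)) i).comp
      (measurePreserving_fst (ν := Measure.pi fun i ↦ unif (vanc i - d / 2) (vanc i + d / 2)))
  have h := hmp.measure_preimage hmeas.nullMeasurableSet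
  exact h.trans_le (measure_pi_unif_abs_sum_gt_le (Uanc i) x hd' hs)

theorem measure_paramUnif_output_gt_le {hd ld : ℕ} (Uanc : Fin hd → Fin ld → ℝ)
    (vanc : Fin hd → ℝ) {d s : ℝ} (hd' : 0 < d) (hs : 0 ≤ s)
    {w : (Fin hd → Fin ld → ℝ) → Fin hd → ℝ} (hw : Measurable w) :
    paramUnif Uanc vanc d
        {p | d * l2norm (w p.1) * s < |∑ i, w p.1 i * (p.2 i - vanc i)|}
      ≤ ENNReal.ofReal (2 * Real.exp (-(2 * s ^ 2))) := by
  have := fun i j ↦ isProbabilityMeasure_unif (Uanc i j) hd'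
  have := fun i ↦ isProbabilityMeasure_unif (vanc i) hd'
  refine measure_prod_le_of_forall_left ?_ fun U ↦
    measure_pi_unif_abs_sum_gt_le vanc (w U) hd' hs
  unfold l2norm
  exact measurableSet_lt (by fun_prop) (by fun_prop)

/-- The difference of the hidden layers `σ(A x) - σ(B x)`. -/
noncomputable def reluGap {hd ld : ℕ} (x : Fin ld → ℝ) (A B : Fin hd → Fin ld → ℝ) :
    Fin hd → ℝ :=
  fun i ↦ max 0 (∑ j, A i j * x j) - max 0 (∑ j, B i j * x j)

theorem measurable_reluGap {hd ld : ℕ} (x : Fin ld → ℝ) :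
    Measurable fun p : (Fin hd → Fin ld → ℝ) × (Fin hd → Fin ld → ℝ) ↦
      reluGap x p.1 p.2 := by
  unfold reluGap
  fun_prop

theorem abs_reluGap_le {hd ld : ℕ} (x : Fin ld → ℝ) (A B : Fin hd → Fin ld → ℝ) (i : Fin hd) :
    |reluGap x A B i| ≤ |∑ j, (A i j - B i j) * x j| := by
  rw [reluGap, max_comm 0, max_comm 0]
  refine (abs_max_sub_max_le_abs _ _ _).trans_eq ?_
  simp only [sub_mul, Finset.sum_sub_distrib]

theorem net_interp_sub {hd ld : ℕ} (U₁ U₂ : Fin hd → Fin ld → ℝ) (v₁ v₂ : Fin hd → ℝ)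
    (x : Fin ld → ℝ) (α : ℝ) :
    net (α • U₁ + (1 - α) • U₂) (α • v₁ + (1 - α) • v₂) x
        - α * net U₁ v₁ x - (1 - α) * net U₂ v₂ x
      = α * (∑ i, v₁ i * reluGap x (α • U₁ + (1 - α) • U₂) U₁ i)
        + (1 - α) * ∑ i, v₂ i * reluGap x (α • U₁ + (1 - α) • U₂) U₂ i := by
  simp only [net, reluGap, Finset.mul_sum, ← Finset.sum_sub_distrib, ← Finset.sum_add_distrib]
  refine Finset.sum_congr rfl fun i _ ↦ ?_
  simp only [Pi.add_apply, Pi.smul_apply, smul_eq_mul]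
  ring

theorem abs_sum_mul_le_of_fluctuation {n : ℕ} {v vanc w : Fin n → ℝ} {d danc s G : ℝ}
    (hd : 0 ≤ d) (hs : 0 ≤ s) (hdanc : 0 ≤ danc) (hvanc : l2norm vanc ≤ danc)
    (hG : l2norm w ≤ G) (h : |∑ i, w i * (v i - vanc i)| ≤ d * l2norm w * s) :
    |∑ i, v i * w i| ≤ G * (danc + d * s) := by
  have hsplit : ∑ i, v i * w i = ∑ i, vanc i * w i + ∑ i, w i * (v i - vanc i) := by
    rw [← Finset.sum_add_distrib]
    exact Finset.sum_congr rfl fun i _ ↦ by ring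
  calc |∑ i, v i * w i| ≤ |∑ i, vanc i * w i| + |∑ i, w i * (v i - vanc i)| :=
        hsplit ▸ abs_add_le _ _
    _ ≤ l2norm vanc * l2norm w + d * l2norm w * s :=
        add_le_add (abs_sum_mul_le_l2norm_mul_l2norm _ _) h
    _ ≤ danc * l2norm w + d * l2norm w * s := by
        gcongr
        exact l2norm_nonneg w
    _ = l2norm w * (danc + d * s) := by ring
    _ ≤ G * (danc + d * s) := by gcongr

theorem abs_net_interp_sub_le {hd ld : ℕ} {b d danc s α : ℝ} (hb : 0 ≤ b) (hd' : 0 ≤ d)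
    (hdanc : 0 ≤ danc) (hs : 0 ≤ s) (hα : α ∈ Set.Icc (0 : ℝ) 1)
    {Uanc U₁ U₂ : Fin hd → Fin ld → ℝ} {vanc v₁ v₂ : Fin hd → ℝ} {x : Fin ld → ℝ}
    (hvanc : l2norm vanc ≤ danc) (hx : l2norm x ≤ b)
    (hU₁ : ∀ i, |∑ j, x j * (U₁ i j - Uanc i j)| ≤ d * l2norm x * s)
    (hU₂ : ∀ i, |∑ j, x j * (U₂ i j - Uanc i j)| ≤ d * l2norm x * s)
    (hv₁ : |∑ i, reluGap x (α • U₁ + (1 - α) • U₂) U₁ i * (v₁ i - vanc i)|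
      ≤ d * l2norm (reluGap x (α • U₁ + (1 - α) • U₂) U₁) * s)
    (hv₂ : |∑ i, reluGap x (α • U₁ + (1 - α) • U₂) U₂ i * (v₂ i - vanc i)|
      ≤ d * l2norm (reluGap x (α • U₁ + (1 - α) • U₂) U₂) * s) :
    |net (α • U₁ + (1 - α) • U₂) (α • v₁ + (1 - α) • v₂) x
        - α * net U₁ v₁ x - (1 - α) * net U₂ v₂ x|
      ≤ Real.sqrt hd * b * d * s * (danc + d * s) := by
  obtain ⟨hα₀, hα₁⟩ := hα
  have hα₁' : 0 ≤ 1 - α := sub_nonneg.2 hα₁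
  have hrow : ∀ i, |∑ j, (U₂ i j - U₁ i j) * x j| ≤ 2 * (d * b * s) := fun i ↦ by
    have hsplit : ∑ j, (U₂ i j - U₁ i j) * x j
        = ∑ j, x j * (U₂ i j - Uanc i j) - ∑ j, x j * (U₁ i j - Uanc i j) := by
      rw [← Finset.sum_sub_distrib]
      exact Finset.sum_congr rfl fun j _ ↦ by ring
    have hle : d * l2norm x * s ≤ d * b * s := by gcongr
    rw [hsplit]
    exact (abs_sub _ _).trans (by linarith [hU₁ i, hU₂ i])
  have hgap₁ : l2norm (reluGap x (α • U₁ + (1 - α) • U₂) U₁)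
      ≤ Real.sqrt hd * ((1 - α) * (2 * (d * b * s))) := by
    refine l2norm_le_sqrt_mul (by positivity) fun i ↦ (abs_reluGap_le _ _ _ _).trans ?_
    have heq : ∑ j, ((α • U₁ + (1 - α) • U₂) i j - U₁ i j) * x j
        = (1 - α) * ∑ j, (U₂ i j - U₁ i j) * x j := by
      rw [Finset.mul_sum]
      refine Finset.sum_congr rfl fun j _ ↦ ?_
      simp only [Pi.add_apply, Pi.smul_apply, smul_eq_mul]
      ring
    rw [heq, abs_mul, abs_of_nonneg hα₁']
    exact mul_le_mul_of_nonneg_left (hrow i) hα₁'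
  have hgap₂ : l2norm (reluGap x (α • U₁ + (1 - α) • U₂) U₂)
      ≤ Real.sqrt hd * (α * (2 * (d * b * s))) := by
    refine l2norm_le_sqrt_mul (by positivity) fun i ↦ (abs_reluGap_le _ _ _ _).trans ?_
    have heq : ∑ j, ((α • U₁ + (1 - α) • U₂) i j - U₂ i j) * x j
        = -(α * ∑ j, (U₂ i j - U₁ i j) * x j) := by
      rw [Finset.mul_sum, ← Finset.sum_neg_distrib]
      refine Finset.sum_congr rfl fun j _ ↦ ?_
      simp only [Pi.add_apply, Pi.smul_apply, smul_eq_mul]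
      ring
    rw [heq, abs_neg, abs_mul, abs_of_nonneg hα₀]
    exact mul_le_mul_of_nonneg_left (hrow i) hα₀
  have h₁ := abs_sum_mul_le_of_fluctuation hd' hs hdanc hvanc hgap₁ hv₁
  have h₂ := abs_sum_mul_le_of_fluctuation hd' hs hdanc hvanc hgap₂ hv₂
  have hα4 : 4 * (α * (1 - α)) ≤ 1 := by nlinarith [sq_nonneg (2 * α - 1)]
  have hK : 0 ≤ Real.sqrt hd * b * d * s * (danc + d * s) := by positivity
  rw [net_interp_sub]
  refine (abs_add_le _ _).trans ?_
  rw [abs_mul, abs_mul, abs_of_nonneg hα₀, abs_of_nonneg hα₁']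
  calc _ ≤ α * (Real.sqrt hd * ((1 - α) * (2 * (d * b * s))) * (danc + d * s))
        + (1 - α) * (Real.sqrt hd * (α * (2 * (d * b * s))) * (danc + d * s)) := by gcongr
    _ = 4 * (α * (1 - α)) * (Real.sqrt hd * b * d * s * (danc + d * s)) := by ring
    _ ≤ _ := mul_le_of_le_one_left hK hα4

theorem interp_bound_le {h b d danc s : ℝ} (hb : 0 ≤ b) (hd : 0 ≤ d) (hdanc : 0 ≤ danc)
    (hs : 0 ≤ s) (hs1 : 1 ≤ 2 * s ^ 2) :
    Real.sqrt h * b * d * s * (danc + d * s)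
      ≤ Real.sqrt 2 / 2 * Real.sqrt h * b * (d ^ 2 + d * danc) * (2 * s ^ 2) := by
  have h2 : (0 : ℝ) ≤ Real.sqrt 2 := Real.sqrt_nonneg 2
  have h22 : Real.sqrt 2 ^ 2 = 2 := Real.sq_sqrt (by norm_num)
  have h21 : 1 ≤ Real.sqrt 2 := Real.one_le_sqrt.2 (by norm_num)
  have hs2 : 1 ≤ Real.sqrt 2 * s := by
    refine (one_le_sq_iff₀ (by positivity)).1 ?_
    rw [mul_pow, h22]
    linarith
  have hA : s ≤ Real.sqrt 2 * s ^ 2 := by nlinarith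
  have hB : s ^ 2 ≤ Real.sqrt 2 * s ^ 2 := le_mul_of_one_le_left (sq_nonneg s) h21
  calc Real.sqrt h * b * d * s * (danc + d * s)
      = Real.sqrt h * b * (d * danc * s + d ^ 2 * s ^ 2) := by ring
    _ ≤ Real.sqrt h * b * (d * danc * (Real.sqrt 2 * s ^ 2) + d ^ 2 * (Real.sqrt 2 * s ^ 2)) := by
        gcongr
    _ = _ := by ring

theorem one_le_log_twelve_mul_div {h δ : ℝ} (hh : 1 ≤ h) (hδ : δ ∈ Set.Ioo (0 : ℝ) 1) :
    1 ≤ Real.log (12 * h / δ) := by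
  obtain ⟨hδ₀, hδ₁⟩ := hδ
  have h12 : 12 ≤ 12 * h / δ := by
    rw [le_div_iff₀ hδ₀]
    nlinarith
  rw [Real.le_log_iff_exp_le (by linarith)]
  linarith [Real.exp_one_lt_d9]

/-- probabilistic core estimate on the interpolation deviation
`z_x(α)` in the proof of Theorem 1. For independent random parameter pairs
`(U₁,v₁)` and `(U₂,v₂)` with independent entries uniform around the anchor
`(U*, v*)` (with `‖v*‖₂ ≤ d_anc`), for any fixed `x` with `‖x‖₂ ≤ b` and
`α ∈ [0,1]`, with probability at least `1 − δ`:
`|(αv₁+(1−α)v₂)ᵀσ((αU₁+(1−α)U₂)x) − αv₁ᵀσ(U₁x) − (1−α)v₂ᵀσ(U₂x)|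
  ≤ (√2/2)·√h·b·(d² + d·d_anc)·log(12h/δ)`. -/
theorem interp_deviation_probabilistic_bound {hd ld : ℕ}
    (hhd : 1 ≤ hd) (hld : 1 ≤ ld)
    (b d danc : ℝ) (hb : 0 < b) (hd' : 0 < d) (hdanc : 0 < danc)
    (δ : ℝ) (hδ : δ ∈ Set.Ioo (0:ℝ) 1)
    (Uanc : Fin hd → Fin ld → ℝ) (vanc : Fin hd → ℝ)
    (hvanc : l2norm vanc ≤ danc)
    (x : Fin ld → ℝ) (hx : l2norm x ≤ b)
    (α : ℝ) (hα : α ∈ Set.Icc (0:ℝ) 1) :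
    ENNReal.ofReal (1 - δ) ≤
      (paramUnif Uanc vanc d).prod (paramUnif Uanc vanc d)
        {wp : ((Fin hd → Fin ld → ℝ) × (Fin hd → ℝ))
            × ((Fin hd → Fin ld → ℝ) × (Fin hd → ℝ)) |
          |net (α • wp.1.1 + (1 - α) • wp.2.1) (α • wp.1.2 + (1 - α) • wp.2.2) x
            - α * net wp.1.1 wp.1.2 x - (1 - α) * net wp.2.1 wp.2.2 x|
          ≤ Real.sqrt 2 / 2 * Real.sqrt hd * b * (d ^ 2 + d * danc)
              * Real.log (12 * hd / δ)} := by
  have hμ := isProbabilityMeasure_paramUnif Uanc vanc hd'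
  have hh : (1 : ℝ) ≤ hd := by exact_mod_cast hhd
  have hlog := one_le_log_twelve_mul_div hh hδ
  obtain ⟨hδ₀, hδ₁⟩ := hδ
  set μ := paramUnif Uanc vanc d
  set L := Real.log (12 * hd / δ) with hL
  set s := Real.sqrt (L / 2)
  have hs : 0 ≤ s := Real.sqrt_nonneg _
  have hsL : 2 * s ^ 2 = L := by
    rw [Real.sq_sqrt (by linarith)]
    ring
  have hp : 2 * Real.exp (-(2 * s ^ 2)) = δ / (6 * hd) := by
    rw [hsL, hL, Real.exp_neg, Real.exp_log (by positivity)]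
    field_simp
    norm_num
  let R : Fin hd → Set ((Fin hd → Fin ld → ℝ) × (Fin hd → ℝ)) := fun i ↦
    {p | d * l2norm x * s < |∑ j, x j * (p.1 i j - Uanc i j)|}
  let V₁ : Set (((Fin hd → Fin ld → ℝ) × (Fin hd → ℝ))
      × ((Fin hd → Fin ld → ℝ) × (Fin hd → ℝ))) :=
    {q | d * l2norm (reluGap x (α • q.1.1 + (1 - α) • q.2.1) q.1.1) * s
      < |∑ i, reluGap x (α • q.1.1 + (1 - α) • q.2.1) q.1.1 i * (q.1.2 i - vanc i)|}
  let V₂ : Set (((Fin hd → Fin ld → ℝ) × (Fin hd → ℝ))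
      × ((Fin hd → Fin ld → ℝ) × (Fin hd → ℝ))) :=
    {q | d * l2norm (reluGap x (α • q.1.1 + (1 - α) • q.2.1) q.2.1) * s
      < |∑ i, reluGap x (α • q.1.1 + (1 - α) • q.2.1) q.2.1 i * (q.2.2 i - vanc i)|}
  have hR : ∀ i, μ (R i) ≤ ENNReal.ofReal (δ / (6 * hd)) := fun i ↦
    hp ▸ measure_paramUnif_row_gt_le Uanc vanc hd' hs x i
  have hRmeas : ∀ i, MeasurableSet (R i) := fun i ↦
    measurableSet_lt (by fun_prop) (by fun_prop)
  have hR₁ : ∀ i, μ.prod μ (Prod.fst ⁻¹' R i) ≤ ENNReal.ofReal (δ / (6 * hd)) := fun i ↦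
    (measurePreserving_fst.measure_preimage (hRmeas i).nullMeasurableSet).trans_le (hR i)
  have hR₂ : ∀ i, μ.prod μ (Prod.snd ⁻¹' R i) ≤ ENNReal.ofReal (δ / (6 * hd)) := fun i ↦
    (measurePreserving_snd.measure_preimage (hRmeas i).nullMeasurableSet).trans_le (hR i)
  have hgap := measurable_reluGap (hd := hd) x
  have hV₁ : μ.prod μ V₁ ≤ ENNReal.ofReal (δ / (6 * hd)) := by
    have hw : Measurable fun q : ((Fin hd → Fin ld → ℝ) × (Fin hd → ℝ))
        × ((Fin hd → Fin ld → ℝ) × (Fin hd → ℝ)) ↦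
        reluGap x (α • q.1.1 + (1 - α) • q.2.1) q.1.1 :=
      hgap.comp (f := fun q : ((Fin hd → Fin ld → ℝ) × (Fin hd → ℝ))
        × ((Fin hd → Fin ld → ℝ) × (Fin hd → ℝ)) ↦
        (α • q.1.1 + (1 - α) • q.2.1, q.1.1)) (by fun_prop)
    refine measure_prod_le_of_forall_right ?_ fun q ↦ hp ▸
      measure_paramUnif_output_gt_le Uanc vanc hd' hs
        (w := fun U ↦ reluGap x (α • U + (1 - α) • q.1) U)
        (hgap.comp (f := fun U ↦ (α • U + (1 - α) • q.1, U)) (by fun_prop))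
    refine measurableSet_lt ?_ ?_
    · unfold l2norm
      fun_prop
    · fun_prop
  have hV₂ : μ.prod μ V₂ ≤ ENNReal.ofReal (δ / (6 * hd)) := by
    have hw : Measurable fun q : ((Fin hd → Fin ld → ℝ) × (Fin hd → ℝ))
        × ((Fin hd → Fin ld → ℝ) × (Fin hd → ℝ)) ↦
        reluGap x (α • q.1.1 + (1 - α) • q.2.1) q.2.1 :=
      hgap.comp (f := fun q : ((Fin hd → Fin ld → ℝ) × (Fin hd → ℝ))
        × ((Fin hd → Fin ld → ℝ) × (Fin hd → ℝ)) ↦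
        (α • q.1.1 + (1 - α) • q.2.1, q.2.1)) (by fun_prop)
    refine measure_prod_le_of_forall_left ?_ fun q ↦ hp ▸
      measure_paramUnif_output_gt_le Uanc vanc hd' hs
        (w := fun U ↦ reluGap x (α • q.1 + (1 - α) • U) U)
        (hgap.comp (f := fun U ↦ (α • q.1 + (1 - α) • U, U)) (by fun_prop))
    refine measurableSet_lt ?_ ?_
    · unfold l2norm
      fun_prop
    · fun_prop
  set B := (⋃ i, Prod.fst ⁻¹' R i) ∪ (⋃ i, Prod.snd ⁻¹' R i) ∪ V₁ ∪ V₂ with hB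
  have hBδ : μ.prod μ B ≤ ENNReal.ofReal δ := by
    have hsum : ∀ f : Fin hd → Set (((Fin hd → Fin ld → ℝ) × (Fin hd → ℝ))
        × ((Fin hd → Fin ld → ℝ) × (Fin hd → ℝ))),
        (∀ i, μ.prod μ (f i) ≤ ENNReal.ofReal (δ / (6 * hd))) →
        μ.prod μ (⋃ i, f i) ≤ ENNReal.ofReal (δ / 6) := fun f hf ↦ by
      refine (measure_iUnion_fintype_le _ _).trans ((Finset.sum_le_sum fun i _ ↦ hf i).trans_eq ?_)
      rw [Finset.sum_const, Finset.card_univ, Fintype.card_fin, ← ENNReal.ofReal_nsmul,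
        nsmul_eq_mul]
      congr 1
      field_simp
    have hle : ENNReal.ofReal (δ / (6 * hd)) ≤ ENNReal.ofReal (δ / 6) :=
      ENNReal.ofReal_le_ofReal (div_le_div_of_nonneg_left hδ₀.le (by norm_num) (by linarith))
    calc μ.prod μ B
        ≤ ENNReal.ofReal (δ / 6) + ENNReal.ofReal (δ / 6) + ENNReal.ofReal (δ / 6)
          + ENNReal.ofReal (δ / 6) :=
          (measure_union_le _ _).trans <| add_le_add
            ((measure_union_le _ _).trans <| add_le_add
              ((measure_union_le _ _).trans <| add_le_add (hsum _ hR₁) (hsum _ hR₂))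
              (hV₁.trans hle)) (hV₂.trans hle)
      _ = ENNReal.ofReal (δ / 6 + δ / 6 + δ / 6 + δ / 6) := by
          rw [ENNReal.ofReal_add, ENNReal.ofReal_add, ENNReal.ofReal_add] <;> positivity
      _ ≤ ENNReal.ofReal δ := ENNReal.ofReal_le_ofReal (by linarith)
  rw [ENNReal.ofReal_sub _ hδ₀.le, ENNReal.ofReal_one, tsub_le_iff_right]
  refine le_trans ?_ (add_le_add le_rfl hBδ)
  rw [← measure_univ (μ := μ.prod μ)]
  refine (measure_mono fun q _ ↦ ?_).trans (measure_union_le _ _)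
  by_cases hq : q ∈ B
  · exact Or.inr hq
  simp only [hB, Set.mem_union, Set.mem_iUnion, Set.mem_preimage, not_or, not_exists] at hq
  obtain ⟨⟨⟨hq₁, hq₂⟩, hq₃⟩, hq₄⟩ := hq
  exact Or.inl <| (abs_net_interp_sub_le hb.le hd'.le hdanc.le hs hα hvanc hx
    (fun i ↦ not_lt.1 (hq₁ i)) (fun i ↦ not_lt.1 (hq₂ i)) (not_lt.1 hq₃) (not_lt.1 hq₄)).trans <|
    hsL ▸ interp_bound_le hb.le hd'.le hdanc.le hs (hsL ▸ hlog)
end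

section
/- Let h, l ≥ 1, K ≥ 2, b, d, d_anc > 0, δ ∈ (0,1). Fix an anchor (U*, v*) with U* ∈ ℝ^{h×l}, v* ∈ ℝ^h, ‖v*‖₂ ≤ d_anc; fix x ∈ ℝ^l with ‖x‖₂ ≤ b. Let (U₁, v₁), …, (U_K, v_K) be independent random parameter pairs whose hl + h scalar entries are all independent, each uniformly distributed on the interval of length d centered at the corresponding entry of (U*, v*). Let Ū = (1/K)∑ Uᵢ and v̄ = (1/K)∑ vᵢ. Then with probability at least 1 − δ: |v̄ᵀσ(Ū x) − (1/K)∑_{i=1}^K vᵢᵀσ(Uᵢ x)| ≤ (√2/2) d (d + d_anc) b √h log(4hK²/δ). -/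
open MeasureTheory

open ProbabilityTheory in
/-- Enlarging the variance proxy preserves sub-Gaussianity. -/
lemma ProbabilityTheory.HasSubgaussianMGF.of_le {Ω : Type*} {mΩ : MeasurableSpace Ω}
    {μ : Measure Ω} {X : Ω → ℝ} {c c' : NNReal} (h : HasSubgaussianMGF X c μ) (hc : c ≤ c') :
    HasSubgaussianMGF X c' μ where
  integrable_exp_mul := h.integrable_exp_mul
  mgf_le t := (h.mgf_le t).trans <| by gcongr

open ProbabilityTheory in
/-- Two-sided Chernoff bound for a sub-Gaussian random variable. -/
lemma ProbabilityTheory.HasSubgaussianMGF.measure_abs_ge_le {Ω : Type*} {mΩ : MeasurableSpace Ω}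
    {μ : Measure Ω} [IsProbabilityMeasure μ] {X : Ω → ℝ} {c : NNReal} {C ε : ℝ}
    (h : HasSubgaussianMGF X c μ) (hc : (c : ℝ) ≤ C) (hε : 0 ≤ ε) :
    μ {ω | ε ≤ |X ω|} ≤ ENNReal.ofReal (2 * Real.exp (-ε ^ 2 / (2 * C))) := by
  lift C to NNReal using c.2.trans hc
  have h' := h.of_le (NNReal.coe_le_coe.mp hc)
  have key : μ.real {ω | ε ≤ |X ω|} ≤ 2 * Real.exp (-ε ^ 2 / (2 * C)) := by
    have hsub : {ω | ε ≤ |X ω|} ⊆ {ω | ε ≤ X ω} ∪ {ω | ε ≤ (-X) ω} := by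
      intro ω hω
      simpa [le_abs] using hω
    calc μ.real {ω | ε ≤ |X ω|} ≤ μ.real {ω | ε ≤ X ω} + μ.real {ω | ε ≤ (-X) ω} :=
          (measureReal_mono hsub).trans (measureReal_union_le _ _)
      _ ≤ 2 * Real.exp (-ε ^ 2 / (2 * C)) := by
          rw [two_mul]
          exact add_le_add (h'.measure_ge_le hε) (h'.neg.measure_ge_le hε)
  rw [← ofReal_measureReal]
  exact ENNReal.ofReal_le_ofReal key

open ProbabilityTheory in
/-- A sum of sub-Gaussian functions of the separate coordinates is sub-Gaussian for the product
measure, and the variance proxies add. -/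
lemma ProbabilityTheory.HasSubgaussianMGF.sum_pi {ι : Type*} [Fintype ι] {Ω : ι → Type*}
    {mΩ : ∀ i, MeasurableSpace (Ω i)} {μ : ∀ i, Measure (Ω i)} [∀ i, IsProbabilityMeasure (μ i)]
    {X : ∀ i, Ω i → ℝ} {c : ι → NNReal} (h : ∀ i, HasSubgaussianMGF (X i) (c i) (μ i)) :
    HasSubgaussianMGF (fun ω => ∑ i, X i (ω i)) (∑ i, c i) (Measure.pi μ) := by
  refine HasSubgaussianMGF.sum_of_iIndepFun (iIndepFun_pi fun i => (h i).aemeasurable) ?_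
  intro i _
  refine HasSubgaussianMGF.of_map (Y := fun ω : ∀ i, Ω i => ω i)
    (measurable_pi_apply i).aemeasurable ?_
  rw [(measurePreserving_eval μ i).map_eq]
  exact h i

lemma isProbabilityMeasure_unif_s16 {a b : ℝ} (hab : a < b) : IsProbabilityMeasure (unif a b) := by
  constructor
  rw [unif, Measure.smul_apply, Measure.restrict_apply_univ, Real.volume_Icc, smul_eq_mul]
  exact ENNReal.inv_mul_cancel (by simpa using hab) ENNReal.ofReal_ne_top

lemma integral_sub_center_unif (a : ℝ) {d : ℝ} (hd : 0 < d) :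
    ∫ y, (y - a) ∂unif (a - d / 2) (a + d / 2) = 0 := by
  rw [unif, integral_smul_measure, integral_Icc_eq_integral_Ioc,
    ← intervalIntegral.integral_of_le (by linarith),
    intervalIntegral.integral_comp_sub_right (fun y => y), integral_id]
  ring_nf

open ProbabilityTheory in
lemma hasSubgaussianMGF_unif (a w : ℝ) {d : ℝ} (hd : 0 < d) :
    HasSubgaussianMGF (fun y => w * (y - a)) (NNReal.mk (w ^ 2) (sq_nonneg w) * (‖d‖₊ / 2) ^ 2)
      (unif (a - d / 2) (a + d / 2)) := by
  have := isProbabilityMeasure_unif_s16 (show a - d / 2 < a + d / 2 by linarith)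
  refine HasSubgaussianMGF.const_mul ?_ w
  have h := hasSubgaussianMGF_of_mem_Icc_of_integral_eq_zero (a := -(d / 2)) (b := d / 2)
    (X := fun y => y - a) (μ := unif (a - d / 2) (a + d / 2)) (by fun_prop) ?_
    (integral_sub_center_unif a hd)
  · rwa [sub_neg_eq_add, add_halves] at h
  · refine Measure.ae_smul_measure ?_ _
    filter_upwards [ae_restrict_mem measurableSet_Icc] with y hy
    constructor <;> linarith [hy.1, hy.2]

/-- If `B` has small sections over the points outside a small set `A`, then `B` is small. -/
lemma measure_prod_le_add {α β : Type*} [MeasurableSpace α] [MeasurableSpace β]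
    {μ : Measure α} {ν : Measure β} [IsProbabilityMeasure μ] [IsProbabilityMeasure ν]
    {A : Set α} {B : Set (α × β)} (hA : MeasurableSet A) (hB : MeasurableSet B) {p q : ENNReal}
    (hp : μ A ≤ p) (hq : ∀ x ∉ A, ν (Prod.mk x ⁻¹' B) ≤ q) : μ.prod ν B ≤ p + q := by
  rw [Measure.prod_apply hB]
  calc ∫⁻ x, ν (Prod.mk x ⁻¹' B) ∂μ ≤ ∫⁻ x, (A.indicator 1 x + q) ∂μ := by
        refine lintegral_mono fun x => ?_
        by_cases hx : x ∈ A
        · simpa [hx] using prob_le_one.trans le_self_add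
        · simpa [hx] using hq x hx
    _ = μ A + q := by
        rw [lintegral_add_right _ measurable_const, lintegral_indicator_one hA]
        simp
    _ ≤ p + q := by gcongr

lemma ofReal_one_sub_le_measure {Ω : Type*} [MeasurableSpace Ω] {μ : Measure Ω}
    [IsProbabilityMeasure μ] {s : Set Ω} {δ : ℝ} (hδ : 0 ≤ δ)
    (h : μ sᶜ ≤ ENNReal.ofReal δ) : ENNReal.ofReal (1 - δ) ≤ μ s := by
  rw [ENNReal.ofReal_sub _ hδ, ENNReal.ofReal_one, tsub_le_iff_right]
  calc (1 : ENNReal) = μ (s ∪ sᶜ) := by simp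
    _ ≤ μ s + μ sᶜ := measure_union_le _ _
    _ ≤ μ s + ENNReal.ofReal δ := by gcongr

lemma sum_abs_le_sqrt_mul_l2norm {n : ℕ} (v : Fin n → ℝ) :
    ∑ i, |v i| ≤ Real.sqrt n * l2norm v := by
  rw [l2norm, ← Real.sqrt_mul (Nat.cast_nonneg n)]
  refine Real.le_sqrt_of_sq_le ?_
  simpa using sq_sum_le_card_mul_sum_sq (s := Finset.univ) (f := fun i => |v i|)

/-- The change in the hidden activation `r` when the first-layer weights of the `k`-th network are
replaced by the mean weights. -/
noncomputable def hiddenGap {hd ld K : ℕ} (U : Fin K → Fin hd → Fin ld → ℝ) (x : Fin ld → ℝ)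
    (k : Fin K) (r : Fin hd) : ℝ :=
  max 0 (∑ j, ((K : ℝ)⁻¹ • ∑ i, U i) r j * x j) - max 0 (∑ j, U k r j * x j)

/-- The coefficients that express the `(k, r)` preactivation gap linearly in all weights. -/
noncomputable def gapCoeff {hd ld K : ℕ} (x : Fin ld → ℝ) (k : Fin K) (r : Fin hd)
    (i : Fin K) (s : Fin hd) (j : Fin ld) : ℝ :=
  ((K : ℝ)⁻¹ - if i = k then 1 else 0) * (if s = r then 1 else 0) * x j

lemma sum_gapCoeff_mul {hd ld K : ℕ} (hK : K ≠ 0) (U : Fin K → Fin hd → Fin ld → ℝ)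
    (Uanc : Fin hd → Fin ld → ℝ) (x : Fin ld → ℝ) (k : Fin K) (r : Fin hd) :
    ∑ i, ∑ s, ∑ j, gapCoeff x k r i s j * (U i s j - Uanc s j)
      = ∑ j, ((K : ℝ)⁻¹ • ∑ i, U i) r j * x j - ∑ j, U k r j * x j := by
  have hK' : (K : ℝ) ≠ 0 := Nat.cast_ne_zero.mpr hK
  have hrow (i : Fin K) : ∑ s, ∑ j, gapCoeff x k r i s j * (U i s j - Uanc s j)
      = ∑ j, ((K : ℝ)⁻¹ - if i = k then 1 else 0) * x j * (U i r j - Uanc r j) := by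
    rw [Finset.sum_eq_single r]
    · simp [gapCoeff]
    · intro s _ hs
      simp [gapCoeff, hs]
    · simp
  simp_rw [hrow]
  rw [Finset.sum_comm, ← Finset.sum_sub_distrib]
  refine Finset.sum_congr rfl fun j _ => ?_
  simp only [Pi.smul_apply, Finset.sum_apply, smul_eq_mul, sub_mul, mul_sub, ite_mul, one_mul,
    zero_mul, Finset.sum_sub_distrib, Finset.sum_ite_eq', Finset.mem_univ, if_true,
    Finset.sum_const, Finset.card_univ, Fintype.card_fin, nsmul_eq_mul]
  rw [← Finset.mul_sum]
  field_simp
  ring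

lemma sum_gapCoeff_sq_le {hd ld K : ℕ} (hK : K ≠ 0) (x : Fin ld → ℝ) (k : Fin K) (r : Fin hd) :
    ∑ i, ∑ s, ∑ j, gapCoeff x k r i s j ^ 2 ≤ l2norm x ^ 2 := by
  have hK' : (K : ℝ) ≠ 0 := Nat.cast_ne_zero.mpr hK
  have hx : l2norm x ^ 2 = ∑ j, x j ^ 2 :=
    Real.sq_sqrt (Finset.sum_nonneg fun j _ => sq_nonneg _)
  have hrow (i : Fin K) : ∑ s, ∑ j, gapCoeff (hd := hd) x k r i s j ^ 2
      = ((K : ℝ)⁻¹ - if i = k then 1 else 0) ^ 2 * ∑ j, x j ^ 2 := by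
    rw [Finset.sum_eq_single r]
    · simp [gapCoeff, mul_pow, Finset.mul_sum]
    · intro s _ hs
      simp [gapCoeff, hs]
    · simp
  have hcoef : ∑ i : Fin K, ((K : ℝ)⁻¹ - if i = k then 1 else 0) ^ 2 = 1 - (K : ℝ)⁻¹ := by
    simp only [sub_sq, ite_pow, one_pow, zero_pow two_ne_zero, mul_ite, mul_one, mul_zero,
      Finset.sum_add_distrib, Finset.sum_sub_distrib, Finset.sum_ite_eq', Finset.mem_univ, if_true,
      Finset.sum_const, Finset.card_univ, Fintype.card_fin, nsmul_eq_mul]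
    field_simp
    ring
  simp_rw [hrow]
  rw [← Finset.sum_mul, hcoef, hx]
  have h0 : (0 : ℝ) ≤ (K : ℝ)⁻¹ := by positivity
  have h1 : 0 ≤ ∑ j, x j ^ 2 := Finset.sum_nonneg fun j _ => sq_nonneg _
  nlinarith

lemma abs_hiddenGap_le {hd ld K : ℕ} (hK : K ≠ 0) (U : Fin K → Fin hd → Fin ld → ℝ)
    (Uanc : Fin hd → Fin ld → ℝ) (x : Fin ld → ℝ) (k : Fin K) (r : Fin hd) :
    |hiddenGap U x k r| ≤ |∑ i, ∑ s, ∑ j, gapCoeff x k r i s j * (U i s j - Uanc s j)| := by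
  rw [sum_gapCoeff_mul hK, hiddenGap, max_comm 0, max_comm 0]
  exact abs_max_sub_max_le_abs _ _ _

/-- The group deviation is the average over the group of `vₖᵀ (σ(Ūx) - σ(Uₖx))`. -/
lemma net_mean_sub_mean_net {hd ld K : ℕ} (U : Fin K → Fin hd → Fin ld → ℝ)
    (v : Fin K → Fin hd → ℝ) (x : Fin ld → ℝ) :
    net ((K : ℝ)⁻¹ • ∑ k, U k) ((K : ℝ)⁻¹ • ∑ k, v k) x - (K : ℝ)⁻¹ * ∑ k, net (U k) (v k) x
      = (K : ℝ)⁻¹ * ∑ k, ∑ r, v k r * hiddenGap U x k r := by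
  simp only [net, hiddenGap, mul_sub, Finset.sum_sub_distrib]
  congr 1
  rw [Finset.sum_comm, Finset.mul_sum]
  refine Finset.sum_congr rfl fun r _ => ?_
  rw [← Finset.sum_mul]
  simp [mul_assoc]

lemma abs_net_mean_sub_mean_net_le {hd ld K : ℕ} (hK : K ≠ 0)
    (U : Fin K → Fin hd → Fin ld → ℝ) (v : Fin K → Fin hd → ℝ) (vanc : Fin hd → ℝ)
    (x : Fin ld → ℝ) {T : ℝ} (hT : ∀ k r, |hiddenGap U x k r| ≤ T) :
    |net ((K : ℝ)⁻¹ • ∑ k, U k) ((K : ℝ)⁻¹ • ∑ k, v k) x - (K : ℝ)⁻¹ * ∑ k, net (U k) (v k) x|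
      ≤ (∑ r, |vanc r|) * T
        + |∑ k, ∑ r, ((K : ℝ)⁻¹ * hiddenGap U x k r) * (v k r - vanc r)| := by
  have hK' : (0 : ℝ) < K := Nat.cast_pos.mpr (Nat.pos_of_ne_zero hK)
  have hsplit : (K : ℝ)⁻¹ * ∑ k, ∑ r, v k r * hiddenGap U x k r
      = (K : ℝ)⁻¹ * ∑ k, ∑ r, vanc r * hiddenGap U x k r
        + ∑ k, ∑ r, ((K : ℝ)⁻¹ * hiddenGap U x k r) * (v k r - vanc r) := by
    simp only [Finset.mul_sum, ← Finset.sum_add_distrib]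
    refine Finset.sum_congr rfl fun k _ => Finset.sum_congr rfl fun r _ => ?_
    ring
  rw [net_mean_sub_mean_net, hsplit]
  refine (abs_add_le _ _).trans (add_le_add_left ?_ _)
  rw [abs_mul, abs_of_pos (inv_pos.mpr hK'), inv_mul_le_iff₀ hK']
  calc |∑ k, ∑ r, vanc r * hiddenGap U x k r|
      ≤ ∑ _k : Fin K, (∑ r, |vanc r|) * T := by
        refine (Finset.abs_sum_le_sum_abs _ _).trans (Finset.sum_le_sum fun k _ => ?_)
        refine (Finset.abs_sum_le_sum_abs _ _).trans ?_
        rw [Finset.sum_mul]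
        refine Finset.sum_le_sum fun r _ => ?_
        rw [abs_mul]
        exact mul_le_mul_of_nonneg_left (hT k r) (abs_nonneg _)
    _ = K * ((∑ r, |vanc r|) * T) := by simp

open ProbabilityTheory in
/-- Hoeffding's inequality for a linear form in the first-layer weights of all the networks. -/
lemma measure_abs_linear_first_layer_ge_le {hd ld K : ℕ} (Uanc : Fin hd → Fin ld → ℝ) {d : ℝ}
    (hd' : 0 < d) (W : Fin K → Fin hd → Fin ld → ℝ) {S ε : ℝ}
    (hS : ∑ i, ∑ s, ∑ j, W i s j ^ 2 ≤ S) (hε : 0 ≤ ε) :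
    (Measure.pi fun _ : Fin K => Measure.pi fun s => Measure.pi fun j =>
        unif (Uanc s j - d / 2) (Uanc s j + d / 2))
      {U | ε ≤ |∑ i, ∑ s, ∑ j, W i s j * (U i s j - Uanc s j)|}
      ≤ ENNReal.ofReal (2 * Real.exp (-ε ^ 2 / (2 * (S * (d / 2) ^ 2)))) := by
  have hpu (s j) : IsProbabilityMeasure (unif (Uanc s j - d / 2) (Uanc s j + d / 2)) :=
    isProbabilityMeasure_unif_s16 (by linarith)
  refine (HasSubgaussianMGF.sum_pi fun i => HasSubgaussianMGF.sum_pi fun s =>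
    HasSubgaussianMGF.sum_pi fun j =>
      hasSubgaussianMGF_unif (Uanc s j) (W i s j) hd').measure_abs_ge_le ?_ hε
  push_cast
  simp only [← Finset.sum_mul, Real.norm_of_nonneg hd'.le]
  gcongr

open ProbabilityTheory in
/-- Hoeffding's inequality for a linear form in the second-layer weights of all the networks. -/
lemma measure_abs_linear_second_layer_ge_le {hd K : ℕ} (vanc : Fin hd → ℝ) {d : ℝ}
    (hd' : 0 < d) (W : Fin K → Fin hd → ℝ) {S ε : ℝ}
    (hS : ∑ i, ∑ s, W i s ^ 2 ≤ S) (hε : 0 ≤ ε) :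
    (Measure.pi fun _ : Fin K => Measure.pi fun s => unif (vanc s - d / 2) (vanc s + d / 2))
      {v | ε ≤ |∑ i, ∑ s, W i s * (v i s - vanc s)|}
      ≤ ENNReal.ofReal (2 * Real.exp (-ε ^ 2 / (2 * (S * (d / 2) ^ 2)))) := by
  have hpv (s) : IsProbabilityMeasure (unif (vanc s - d / 2) (vanc s + d / 2)) :=
    isProbabilityMeasure_unif_s16 (by linarith)
  refine (HasSubgaussianMGF.sum_pi fun i => HasSubgaussianMGF.sum_pi fun s =>
      hasSubgaussianMGF_unif (vanc s) (W i s) hd').measure_abs_ge_le ?_ hε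
  push_cast
  simp only [← Finset.sum_mul, Real.norm_of_nonneg hd'.le]
  gcongr

/-- Outside an event of probability `2hK exp(-L)`, all preactivation gaps are smaller than
`d b √(L / 2)`. -/
lemma measure_exists_preactivation_gap_ge_le {hd ld K : ℕ} (hK : K ≠ 0)
    (Uanc : Fin hd → Fin ld → ℝ) {b d L : ℝ} (hb : 0 < b) (hd' : 0 < d) (hL : 0 ≤ L)
    (x : Fin ld → ℝ) (hx : l2norm x ≤ b) :
    (Measure.pi fun _ : Fin K => Measure.pi fun s => Measure.pi fun j =>
        unif (Uanc s j - d / 2) (Uanc s j + d / 2))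
      (⋃ p : Fin K × Fin hd, {U | d * b * Real.sqrt (L / 2) ≤
        |∑ i, ∑ s, ∑ j, gapCoeff x p.1 p.2 i s j * (U i s j - Uanc s j)|})
      ≤ ENNReal.ofReal (2 * hd * K * Real.exp (-L)) := by
  refine (measure_iUnion_fintype_le _ _).trans ?_
  have hS (p : Fin K × Fin hd) :
      ∑ i, ∑ s, ∑ j, gapCoeff x p.1 p.2 i s j ^ 2 ≤ b ^ 2 :=
    (sum_gapCoeff_sq_le hK x p.1 p.2).trans
      (pow_le_pow_left₀ (Real.sqrt_nonneg _) hx 2)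
  have hexp : -(d * b * Real.sqrt (L / 2)) ^ 2 / (2 * (b ^ 2 * (d / 2) ^ 2)) = -L := by
    rw [mul_pow, Real.sq_sqrt (by positivity)]
    field_simp
  calc _ ≤ ∑ _p : Fin K × Fin hd, ENNReal.ofReal (2 * Real.exp (-L)) := by
        refine Finset.sum_le_sum fun p _ => ?_
        rw [← hexp]
        exact measure_abs_linear_first_layer_ge_le Uanc hd' _ (hS p) (by positivity)
    _ = ENNReal.ofReal (2 * hd * K * Real.exp (-L)) := by
        rw [← ENNReal.ofReal_sum_of_nonneg fun _ _ => by positivity]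
        congr 1
        simp
        ring

/-- If all hidden activation gaps are at most `d b √(L / 2)`, then the part of the group deviation
coming from the second-layer noise is large only with probability `2 exp(-2L)`. -/
lemma measure_abs_second_layer_noise_ge_le {hd ld K : ℕ} (hhd : 1 ≤ hd) (hK : 1 ≤ K)
    (vanc : Fin hd → ℝ) {b d L : ℝ} (hb : 0 < b) (hd' : 0 < d) (hL : 0 < L)
    (U : Fin K → Fin hd → Fin ld → ℝ) (x : Fin ld → ℝ)
    (hT : ∀ k r, |hiddenGap U x k r| ≤ d * b * Real.sqrt (L / 2)) :
    (Measure.pi fun _ : Fin K => Measure.pi fun s => unif (vanc s - d / 2) (vanc s + d / 2))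
      {v | Real.sqrt 2 / 2 * d ^ 2 * b * Real.sqrt hd * L ≤
        |∑ k, ∑ r, ((K : ℝ)⁻¹ * hiddenGap U x k r) * (v k r - vanc r)|}
      ≤ ENNReal.ofReal (2 * Real.exp (-(2 * L))) := by
  have hK' : (1 : ℝ) ≤ K := Nat.one_le_cast.mpr hK
  have hh : (0 : ℝ) < hd := Nat.cast_pos.mpr hhd
  have hS : ∑ k, ∑ r, ((K : ℝ)⁻¹ * hiddenGap U x k r) ^ 2 ≤ hd * (d ^ 2 * b ^ 2 * (L / 2)) := by
    have hgap (k r) : hiddenGap U x k r ^ 2 ≤ d ^ 2 * b ^ 2 * (L / 2) := by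
      calc hiddenGap U x k r ^ 2 = |hiddenGap U x k r| ^ 2 := (sq_abs _).symm
        _ ≤ (d * b * Real.sqrt (L / 2)) ^ 2 := pow_le_pow_left₀ (abs_nonneg _) (hT k r) 2
        _ = d ^ 2 * b ^ 2 * (L / 2) := by
            rw [mul_pow, mul_pow, Real.sq_sqrt (by positivity)]
    calc ∑ k, ∑ r, ((K : ℝ)⁻¹ * hiddenGap U x k r) ^ 2
        ≤ ∑ _k : Fin K, ∑ _r : Fin hd, (K : ℝ)⁻¹ ^ 2 * (d ^ 2 * b ^ 2 * (L / 2)) := by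
          refine Finset.sum_le_sum fun k _ => Finset.sum_le_sum fun r _ => ?_
          rw [mul_pow]
          exact mul_le_mul_of_nonneg_left (hgap k r) (by positivity)
      _ = (K : ℝ)⁻¹ * (hd * (d ^ 2 * b ^ 2 * (L / 2))) := by
          simp only [Finset.sum_const, Finset.card_univ, Fintype.card_fin, nsmul_eq_mul]
          field_simp
      _ ≤ hd * (d ^ 2 * b ^ 2 * (L / 2)) :=
          mul_le_of_le_one_left (by positivity) (inv_le_one_of_one_le₀ hK')
  refine (measure_abs_linear_second_layer_ge_le vanc hd' _ hS (by positivity)).trans_eq ?_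
  congr 3
  simp only [mul_pow, div_pow, Real.sq_sqrt hh.le, Real.sq_sqrt (zero_le_two (α := ℝ))]
  field_simp


/-- probabilistic core estimate (proof:fed_1)–(proof:fed_2) on
the group deviation `z(x)` in the proof of Theorem 2. For `K ≥ 2` independent
random parameter pairs `(Uᵢ,vᵢ)` with independent entries uniform around the
anchor `(U*,v*)` (with `‖v*‖₂ ≤ d_anc`), for any fixed `x` with `‖x‖₂ ≤ b`, with
probability at least `1 − δ`:
`|v̄ᵀσ(Ūx) − (1/K)∑ vᵢᵀσ(Uᵢx)| ≤ (√2/2)·d(d + d_anc)·b·√h·log(4hK²/δ)`. -/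
theorem group_deviation_probabilistic_bound {hd ld : ℕ}
    (hhd : 1 ≤ hd) (hld : 1 ≤ ld) (K : ℕ) (hK : 2 ≤ K)
    (b d danc : ℝ) (hb : 0 < b) (hd' : 0 < d) (hdanc : 0 < danc)
    (δ : ℝ) (hδ : δ ∈ Set.Ioo (0:ℝ) 1)
    (Uanc : Fin hd → Fin ld → ℝ) (vanc : Fin hd → ℝ)
    (hvanc : l2norm vanc ≤ danc)
    (x : Fin ld → ℝ) (hx : l2norm x ≤ b) :
    ENNReal.ofReal (1 - δ) ≤
      (Measure.pi fun _ : Fin K => paramUnif Uanc vanc d)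
        {ws : Fin K → (Fin hd → Fin ld → ℝ) × (Fin hd → ℝ) |
          |net ((K : ℝ)⁻¹ • ∑ k, (ws k).1) ((K : ℝ)⁻¹ • ∑ k, (ws k).2) x
            - (K : ℝ)⁻¹ * ∑ k, net (ws k).1 (ws k).2 x|
          ≤ Real.sqrt 2 / 2 * d * (d + danc) * b * Real.sqrt hd
              * Real.log (4 * hd * (K : ℝ) ^ 2 / δ)} := by
  have hK0 : K ≠ 0 := by omega
  have hh1 : (1 : ℝ) ≤ hd := Nat.one_le_cast.mpr hhd
  have hK2 : (2 : ℝ) ≤ K := by exact_mod_cast hK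
  obtain ⟨hδ0, hδ1⟩ := hδ
  set L : ℝ := Real.log (4 * hd * (K : ℝ) ^ 2 / δ) with hLdef
  have harg : 0 < 4 * hd * (K : ℝ) ^ 2 / δ := by positivity
  have hexpL : Real.exp (-L) = δ / (4 * hd * (K : ℝ) ^ 2) := by
    rw [hLdef, Real.exp_neg, Real.exp_log harg, inv_div]
  have hL1 : 1 ≤ L := by
    rw [hLdef, Real.le_log_iff_exp_le harg, le_div_iff₀ hδ0]
    nlinarith [Real.exp_one_lt_d9, Real.exp_pos 1, mul_le_mul hh1 hK2 zero_le_two (by positivity)]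
  have hpu (s j) : IsProbabilityMeasure (unif (Uanc s j - d / 2) (Uanc s j + d / 2)) :=
    isProbabilityMeasure_unif_s16 (by linarith)
  have hpv (s) : IsProbabilityMeasure (unif (vanc s - d / 2) (vanc s + d / 2)) :=
    isProbabilityMeasure_unif_s16 (by linarith)
  have hpp : IsProbabilityMeasure (paramUnif Uanc vanc d) := by
    unfold paramUnif
    infer_instance
  refine ofReal_one_sub_le_measure hδ0.le ?_
  let bad : Set ((Fin K → Fin hd → Fin ld → ℝ) × (Fin K → Fin hd → ℝ)) :=
    {p | Real.sqrt 2 / 2 * d * (d + danc) * b * Real.sqrt hd * L <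
      |net ((K : ℝ)⁻¹ • ∑ k, p.1 k) ((K : ℝ)⁻¹ • ∑ k, p.2 k) x
        - (K : ℝ)⁻¹ * ∑ k, net (p.1 k) (p.2 k) x|}
  have hbad : MeasurableSet bad := by
    refine measurableSet_lt measurable_const (Continuous.measurable ?_)
    simp only [net, Pi.smul_apply, Finset.sum_apply, smul_eq_mul]
    fun_prop
  have hmp := measurePreserving_arrowProdEquivProdArrow (Fin hd → Fin ld → ℝ) (Fin hd → ℝ) (Fin K)
    (fun _ => Measure.pi fun s => Measure.pi fun j =>
      unif (Uanc s j - d / 2) (Uanc s j + d / 2))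
    (fun _ => Measure.pi fun s => unif (vanc s - d / 2) (vanc s + d / 2))
  have hpre : {ws : Fin K → (Fin hd → Fin ld → ℝ) × (Fin hd → ℝ) |
      |net ((K : ℝ)⁻¹ • ∑ k, (ws k).1) ((K : ℝ)⁻¹ • ∑ k, (ws k).2) x
        - (K : ℝ)⁻¹ * ∑ k, net (ws k).1 (ws k).2 x|
      ≤ Real.sqrt 2 / 2 * d * (d + danc) * b * Real.sqrt hd * L}ᶜ
      = MeasurableEquiv.arrowProdEquivProdArrow (Fin hd → Fin ld → ℝ) (Fin hd → ℝ) (Fin K)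
        ⁻¹' bad := by
    ext ws
    simp only [Set.mem_compl_iff, Set.mem_ofPred_eq, not_le]
    rfl
  rw [hpre]
  refine (hmp.measure_preimage_equiv bad).trans_le ?_
  calc _ ≤ ENNReal.ofReal (2 * hd * K * Real.exp (-L)) +
        ENNReal.ofReal (2 * Real.exp (-(2 * L))) := by
        refine measure_prod_le_add ?_ hbad
          (measure_exists_preactivation_gap_ge_le hK0 Uanc hb hd' (by linarith) x hx) ?_
        · exact MeasurableSet.iUnion fun p =>
            measurableSet_le measurable_const (Continuous.measurable (by fun_prop))
        · intro U hU
          have hT (k r) : |hiddenGap U x k r| ≤ d * b * Real.sqrt (L / 2) := by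
            simp only [Set.mem_iUnion, Set.mem_ofPred_eq, not_exists, not_le] at hU
            exact (abs_hiddenGap_le hK0 U Uanc x k r).trans (hU (k, r)).le
          refine le_trans (measure_mono ?_) (measure_abs_second_layer_noise_ge_le hhd
            (by omega) vanc hb hd' (by linarith) U x hT)
          intro v hv
          have hdev := abs_net_mean_sub_mean_net_le hK0 U v vanc x hT
          have hanc : (∑ r, |vanc r|) * (d * b * Real.sqrt (L / 2))
              ≤ Real.sqrt 2 / 2 * d * danc * b * Real.sqrt hd * L := by
            have hsum : ∑ r, |vanc r| ≤ Real.sqrt hd * danc :=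
              (sum_abs_le_sqrt_mul_l2norm vanc).trans (by gcongr)
            have hsqrt : Real.sqrt (L / 2) ≤ Real.sqrt 2 / 2 * L := by
              refine Real.sqrt_le_iff.mpr ⟨by positivity, ?_⟩
              rw [mul_pow, div_pow, Real.sq_sqrt zero_le_two]
              nlinarith
            calc _ ≤ (Real.sqrt hd * danc) * (d * b * (Real.sqrt 2 / 2 * L)) := by gcongr
              _ = _ := by ring
          have hv' : Real.sqrt 2 / 2 * d * (d + danc) * b * Real.sqrt hd * L < _ := hv
          rw [Set.mem_ofPred_eq]
          linarith
    _ ≤ ENNReal.ofReal δ := by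
        rw [← ENNReal.ofReal_add (by positivity) (by positivity)]
        refine ENNReal.ofReal_le_ofReal ?_
        have hsq : Real.exp (-(2 * L)) ≤ Real.exp (-L) := Real.exp_le_exp.mpr (by linarith)
        have hfirst : 2 * hd * K * Real.exp (-L) ≤ δ / 2 := by
          rw [hexpL]
          have : 2 * hd * K * (δ / (4 * hd * (K : ℝ) ^ 2)) = δ / 2 * (K : ℝ)⁻¹ := by
            field_simp
            norm_num
          rw [this]
          exact mul_le_of_le_one_right (by positivity) (inv_le_one_of_one_le₀ (by linarith))
        have hsecond : 2 * Real.exp (-L) ≤ 2 * hd * K * Real.exp (-L) := by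
          have : (1 : ℝ) ≤ hd * K := by nlinarith
          nlinarith [Real.exp_pos (-L)]
        linarith
end
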